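/- arXiv:math/0006178 — 6 statements merged into one kernel-verified Lean document; each statement's English description precedes it below -/
import Mathlib

section
/- Let d ≥ 2 be an integer, let U be an open subset of ℝ^{d−1}, and let Φ : S¹ × U → ℝ^d be a bi-Lipschitz embedding, i.e. Φ is Lipschitz and there exists c > 0 such that ‖Φ(p) − Φ(q)‖ ≥ c · dist(p, q) for all p, q ∈ S¹ × U. If E ⊆ ℝ^d satisfies μH[d−1](E) = 0, then for Lebesgue-almost every x ∈ U one has Φ(ζ, x) ∉ E for every ζ ∈ S¹. -/
open Metric MeasureTheory

/-- A set of vanishing top-dimensional Hausdorff measure in Euclidean space is Lebesgue-null. -/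
theorem EuclideanSpace.volume_eq_zero_of_hausdorffMeasure_eq_zero {ι : Type*} [Fintype ι]
    {s : Set (EuclideanSpace ℝ ι)} (hs : μH[(Fintype.card ι : ℝ)] s = 0) :
    volume s = 0 := by
  have himage : μH[(Fintype.card ι : ℝ)] ((WithLp.ofLp : EuclideanSpace ℝ ι → ι → ℝ) '' s) = 0 := by
    have h := (PiLp.lipschitzWith_ofLp 2 fun _ : ι => ℝ).hausdorffMeasure_image_le
      (Nat.cast_nonneg (Fintype.card ι)) s
    rwa [hs, mul_zero, nonpos_iff_eq_zero] at h
  rw [hausdorffMeasure_pi_real] at himage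
  exact measure_mono_null (Set.subset_preimage_image WithLp.ofLp s)
    ((PiLp.volume_preserving_ofLp ι).quasiMeasurePreserving.preimage_null himage)

/-- If `f` expands distances by at least a factor `c > 0` on `s`, and `g` is `1`-Lipschitz,
then the `g`-image of the part of `s` mapped by `f` into a `μH[r]`-null set is `μH[r]`-null. -/
theorem hausdorffMeasure_image_inter_preimage_eq_zero {X Y Z : Type*}
    [PseudoMetricSpace X] [MetricSpace Y] [MeasurableSpace Y] [BorelSpace Y]
    [MetricSpace Z] [MeasurableSpace Z] [BorelSpace Z]
    {f : X → Y} {g : X → Z} {s : Set X} {c r : ℝ} (hc : 0 < c) (hr : 0 ≤ r)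
    (hf : ∀ p ∈ s, ∀ q ∈ s, c * dist p q ≤ dist (f p) (f q)) (hg : LipschitzWith 1 g)
    {t : Set Y} (ht : μH[r] t = 0) :
    μH[r] (g '' (s ∩ f ⁻¹' t)) = 0 := by
  rcases s.eq_empty_or_nonempty with rfl | ⟨p₀, -⟩
  · simp
  have : Nonempty X := ⟨p₀⟩
  have hinv (y) (hy : y ∈ f '' s) :
      Function.invFunOn f s y ∈ s ∧ f (Function.invFunOn f s y) = y :=
    ⟨Function.invFunOn_mem hy, Function.invFunOn_eq hy⟩
  have hlip : LipschitzOnWith (Real.toNNReal c⁻¹) (g ∘ Function.invFunOn f s) (f '' s ∩ t) := by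
    refine LipschitzOnWith.of_dist_le_mul fun y hy z hz => ?_
    obtain ⟨hys, hyf⟩ := hinv y hy.1
    obtain ⟨hzs, hzf⟩ := hinv z hz.1
    have h := hf _ hys _ hzs
    rw [hyf, hzf] at h
    rw [Real.coe_toNNReal _ (inv_nonneg.2 hc.le), ← div_eq_inv_mul, le_div_iff₀' hc]
    refine le_trans (mul_le_mul_of_nonneg_left ?_ hc.le) h
    simpa using hg.dist_le_mul (Function.invFunOn f s y) (Function.invFunOn f s z)
  have h := hlip.hausdorffMeasure_image_le hr
  rw [measure_mono_null Set.inter_subset_right ht, mul_zero, nonpos_iff_eq_zero] at h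
  refine measure_mono_null ?_ h
  rintro _ ⟨p, ⟨hps, hpt⟩, rfl⟩
  have hmem : f p ∈ f '' s := ⟨p, hps, rfl⟩
  refine ⟨f p, ⟨hmem, hpt⟩, ?_⟩
  obtain ⟨hqs, hqf⟩ := hinv _ hmem
  have hle := hf _ hqs _ hps
  rw [hqf, dist_self] at hle
  have hdist : dist (Function.invFunOn f s (f p)) p ≤ 0 := nonpos_of_mul_nonpos_right hle hc
  exact dist_le_zero.1 (((hg.dist_le_mul _ _).trans_eq (by simp)).trans hdist)

/-- Lemma 4.1 (ii), circle version: if `E` has vanishing `(d-1)`-dimensional Hausdorff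
measure, then for Lebesgue-almost every parameter `x ∈ U` the circle slice
`Φ(S¹ × {x})` avoids `E`. -/
theorem stmt_1 (d : ℕ) (hd : 2 ≤ d)
    (U : Set (EuclideanSpace ℝ (Fin (d - 1)))) (hU : IsOpen U)
    (Φ : ℂ × EuclideanSpace ℝ (Fin (d - 1)) → EuclideanSpace ℝ (Fin d))
    (K : NNReal) (hLip : LipschitzOnWith K Φ (sphere (0 : ℂ) 1 ×ˢ U))
    (c : ℝ) (hc : 0 < c)
    (hlow : ∀ p ∈ sphere (0 : ℂ) 1 ×ˢ U, ∀ q ∈ sphere (0 : ℂ) 1 ×ˢ U,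
      c * dist p q ≤ dist (Φ p) (Φ q))
    (E : Set (EuclideanSpace ℝ (Fin d)))
    (hE : μH[(d : ℝ) - 1] E = 0) :
    ∀ᵐ x ∂(volume : Measure (EuclideanSpace ℝ (Fin (d - 1)))),
      x ∈ U → ∀ ζ ∈ sphere (0 : ℂ) 1, Φ (ζ, x) ∉ E := by
  have hdim : ((Fintype.card (Fin (d - 1)) : ℕ) : ℝ) = (d : ℝ) - 1 := by
    rw [Fintype.card_fin, Nat.cast_sub (by lia), Nat.cast_one]
  rw [← hdim] at hE
  have h := EuclideanSpace.volume_eq_zero_of_hausdorffMeasure_eq_zero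
    (hausdorffMeasure_image_inter_preimage_eq_zero hc (Nat.cast_nonneg _) hlow
      LipschitzWith.prod_snd hE)
  filter_upwards [measure_eq_zero_iff_ae_notMem.1 h] with x hx hxU ζ hζ hmem
  exact hx ⟨(ζ, x), ⟨⟨hζ, hxU⟩, hmem⟩, rfl⟩
end

section
/- Let d ≥ 2 be an integer, let U be an open subset of ℝ^{d−1}, and let Ψ : (0,1) × U → ℝ^d be a bi-Lipschitz embedding, i.e. Ψ is Lipschitz and there exists c > 0 such that ‖Ψ(p) − Ψ(q)‖ ≥ c · dist(p, q) for all p, q ∈ (0,1) × U. Then: (i) if E ⊆ ℝ^d satisfies μH[d−2](E) = 0, the set {x ∈ U : ∃ t ∈ (0,1), Ψ(t, x) ∈ E} has (d−2)-dimensional Hausdorff measure zero as a subset of ℝ^{d−1}; (ii) if E ⊆ ℝ^d satisfies μH[d−1](E) = 0, then for Lebesgue-almost every x ∈ U one has Ψ(t, x) ∉ E for every t ∈ (0,1). -/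
open Metric MeasureTheory

/-- If `Ψ` expands distances on `S` at least by a factor `c > 0`, then the image under a
`1`-Lipschitz map of the points of `S` lying over a `μH[s]`-null set is `μH[s]`-null. -/
theorem hausdorffMeasure_image_preimage_eq_zero_of_le_dist {X Y Z : Type*} [MetricSpace X]
    [MetricSpace Y] [MeasurableSpace Y] [BorelSpace Y]
    [MetricSpace Z] [MeasurableSpace Z] [BorelSpace Z]
    {Ψ : X → Y} {π : X → Z} {S : Set X} {E : Set Y} {c s : ℝ} (hπ : LipschitzWith 1 π)
    (hc : 0 < c) (hs : 0 ≤ s) (hlow : ∀ p ∈ S, ∀ q ∈ S, c * dist p q ≤ dist (Ψ p) (Ψ q))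
    (hE : μH[s] E = 0) : μH[s] (π '' (S ∩ Ψ ⁻¹' E)) = 0 := by
  have hA : AntilipschitzWith c⁻¹.toNNReal (S.domRestrict Ψ) := by
    refine AntilipschitzWith.of_le_mul_dist fun p q ↦ ?_
    rw [Real.coe_toNNReal _ (inv_nonneg.2 hc.le), ← div_eq_inv_mul, le_div_iff₀' hc]
    exact hlow p p.2 q q.2
  borelize X
  have h1 : μH[s] (S.domRestrict Ψ ⁻¹' E) = 0 := by
    simpa [hE] using hA.hausdorffMeasure_preimage_le hs E
  have h2 : LipschitzWith 1 (fun p : S ↦ π p) := by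
    simpa [Function.comp_def] using hπ.comp (LipschitzWith.subtype_val S)
  have h3 := h2.hausdorffMeasure_image_le hs (S.domRestrict Ψ ⁻¹' E)
  have h4 : (fun p : S ↦ π p) '' (S.domRestrict Ψ ⁻¹' E) = π '' (S ∩ Ψ ⁻¹' E) := by
    ext z
    simp [Set.domRestrict, and_assoc, and_left_comm]
  simpa [h1, h4] using h3

/-- Lemma 4.1, segment version: for a bi-Lipschitz family of segments
`Ψ : (0,1) × U → ℝ^d`, (i) if `μH[d-2] E = 0` then the set of parameters whose
segment meets `E` has vanishing `(d-2)`-dimensional Hausdorff measure, and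
(ii) if `μH[d-1] E = 0` then almost every segment avoids `E`. -/
theorem stmt_2 (d : ℕ) (hd : 2 ≤ d)
    (U : Set (EuclideanSpace ℝ (Fin (d - 1)))) (hU : IsOpen U)
    (Ψ : ℝ × EuclideanSpace ℝ (Fin (d - 1)) → EuclideanSpace ℝ (Fin d))
    (K : NNReal) (hLip : LipschitzOnWith K Ψ (Set.Ioo (0 : ℝ) 1 ×ˢ U))
    (c : ℝ) (hc : 0 < c)
    (hlow : ∀ p ∈ Set.Ioo (0 : ℝ) 1 ×ˢ U, ∀ q ∈ Set.Ioo (0 : ℝ) 1 ×ˢ U,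
      c * dist p q ≤ dist (Ψ p) (Ψ q)) :
    (∀ E : Set (EuclideanSpace ℝ (Fin d)), μH[(d : ℝ) - 2] E = 0 →
      μH[(d : ℝ) - 2] {x | x ∈ U ∧ ∃ t ∈ Set.Ioo (0 : ℝ) 1, Ψ (t, x) ∈ E} = 0) ∧
    (∀ E : Set (EuclideanSpace ℝ (Fin d)), μH[(d : ℝ) - 1] E = 0 →
      ∀ᵐ x ∂(volume : Measure (EuclideanSpace ℝ (Fin (d - 1)))),
        x ∈ U → ∀ t ∈ Set.Ioo (0 : ℝ) 1, Ψ (t, x) ∉ E) := by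
  have key : ∀ (s : ℝ), 0 ≤ s → ∀ E : Set (EuclideanSpace ℝ (Fin d)), μH[s] E = 0 →
      μH[s] {x | x ∈ U ∧ ∃ t ∈ Set.Ioo (0 : ℝ) 1, Ψ (t, x) ∈ E} = 0 := by
    intro s hs E hE
    refine measure_mono_null ?_
      (hausdorffMeasure_image_preimage_eq_zero_of_le_dist LipschitzWith.prod_snd hc hs hlow hE)
    rintro x ⟨hx, t, ht, hxE⟩
    exact ⟨(t, x), ⟨⟨ht, hx⟩, hxE⟩, rfl⟩
  have hd' : (2 : ℝ) ≤ d := by exact_mod_cast hd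
  refine ⟨key _ (by linarith), fun E hE ↦ ?_⟩
  have hdim : (Module.finrank ℝ (EuclideanSpace ℝ (Fin (d - 1))) : ℝ) = (d : ℝ) - 1 := by
    rw [finrank_euclideanSpace_fin, Nat.cast_sub (by lia), Nat.cast_one]
  have hac : (volume : Measure (EuclideanSpace ℝ (Fin (d - 1)))) ≪ μH[(d : ℝ) - 1] := by
    rw [← hdim]
    exact Measure.absolutelyContinuous_isAddHaarMeasure _ _
  have hae := measure_eq_zero_iff_ae_notMem.1 (hac (key _ (by linarith) E hE))
  filter_upwards [hae] with x hx hxU t ht hxE using hx ⟨hxU, t, ht, hxE⟩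
end

section
/- For every ε > 0 and every natural number ℓ there exists a function h : ℂ → ℂ such that: (1) h is complex-differentiable at every point of the open unit disc; (2) the restriction of h to the closed unit disc is C^∞ in the real sense; (3) h(ζ) ≠ 0 for every ζ in the closed unit disc; and (4) for every θ ∈ ℝ with |θ| ≤ π − ε/8, the number (e^{iθ})^ℓ · h(e^{iθ}) is real. -/
open Metric

open scoped FourierTransform SchwartzMap ContDiff

section PowerSeries

variable {a : ℕ → ℂ}

lemma norm_mul_pow_le_of_mem_closedBall (c : ℂ) (n : ℕ) {z : ℂ}
    (hz : z ∈ closedBall (0 : ℂ) 1) : ‖c * z ^ n‖ ≤ ‖c‖ := by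
  rw [norm_mul, norm_pow]
  exact mul_le_of_le_one_right (norm_nonneg _)
    (pow_le_one₀ (norm_nonneg _) (by simpa using hz))

lemma continuousOn_tsum_mul_pow (ha : Summable fun n ↦ ‖a n‖) :
    ContinuousOn (fun z ↦ ∑' n, a n * z ^ n) (closedBall (0 : ℂ) 1) :=
  continuousOn_tsum (fun n ↦ by fun_prop) ha
    fun n _ hz ↦ norm_mul_pow_le_of_mem_closedBall (a n) n hz

lemma summable_norm_succ_mul {k : ℕ} (ha : Summable fun n : ℕ ↦ (n : ℝ) ^ (k + 1) * ‖a n‖) :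
    Summable fun n : ℕ ↦ (n : ℝ) ^ k * ‖((n + 1 : ℕ) : ℂ) * a (n + 1)‖ := by
  refine ((summable_nat_add_iff 1).2 ha).of_nonneg_of_le (fun n ↦ by positivity) fun n ↦ ?_
  rw [norm_mul, Complex.norm_natCast, pow_succ, mul_assoc]
  gcongr
  linarith

lemma hasDerivAt_tsum_mul_pow (ha : Summable fun n ↦ ‖a n‖)
    (ha' : Summable fun n : ℕ ↦ (n : ℝ) * ‖a n‖) {z : ℂ} (hz : z ∈ ball (0 : ℂ) 1) :
    HasDerivAt (fun z ↦ ∑' n, a n * z ^ n)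
      (∑' n : ℕ, (((n + 1 : ℕ) : ℂ) * a (n + 1)) * z ^ n) z := by
  have hb : ∀ (n : ℕ) (y : ℂ), y ∈ ball (0 : ℂ) 1 → ‖a n * (n * y ^ (n - 1))‖ ≤ n * ‖a n‖ := by
    intro n y hy
    have := norm_mul_pow_le_of_mem_closedBall (a n * n) (n - 1) (ball_subset_closedBall hy)
    rw [mul_assoc] at this
    refine this.trans_eq ?_
    rw [norm_mul, Complex.norm_natCast, mul_comm]
  have key := hasDerivAt_tsum_of_isPreconnected (g := fun n z ↦ a n * z ^ n) ha' isOpen_ball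
    (convex_ball (0 : ℂ) 1).isPreconnected
    (fun n y _ ↦ (hasDerivAt_pow n y).const_mul (a n)) hb hz
    (ha.of_norm_bounded fun n ↦
      norm_mul_pow_le_of_mem_closedBall (a n) n (ball_subset_closedBall hz)) hz
  refine key.congr_deriv ?_
  rw [(ha'.of_norm_bounded fun n ↦ hb n z hz).tsum_eq_zero_add]
  simp only [Nat.cast_zero, zero_mul, mul_zero, zero_add, Nat.add_sub_cancel]
  exact tsum_congr fun n ↦ by ring

/-- A function holomorphic in the open unit disc, such that both it and its derivative extend
continuously to the closed disc, is differentiable within the closed disc. -/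
lemma hasFDerivWithinAt_closedBall_of_continuousOn {f f' : ℂ → ℂ}
    (hf : ContinuousOn f (closedBall (0 : ℂ) 1)) (hf' : ContinuousOn f' (closedBall (0 : ℂ) 1))
    (h : ∀ z ∈ ball (0 : ℂ) 1, HasDerivAt f (f' z) z) {z : ℂ} (hz : z ∈ closedBall (0 : ℂ) 1) :
    HasFDerivWithinAt f (f' z • (1 : ℂ →L[ℝ] ℂ)) (closedBall (0 : ℂ) 1) z := by
  have hd : ∀ y ∈ ball (0 : ℂ) 1, HasFDerivAt f (f' y • (1 : ℂ →L[ℝ] ℂ)) y :=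
    fun y hy ↦ (h y hy).complexToReal_fderiv
  have hcl : closure (ball (0 : ℂ) 1) = closedBall 0 1 := closure_ball 0 one_ne_zero
  rw [← hcl]
  refine hasFDerivWithinAt_closure_of_tendsto_fderiv
    (fun y hy ↦ (hd y hy).differentiableAt.differentiableWithinAt) (convex_ball 0 1) isOpen_ball
    (fun y hy ↦ (hf y (hcl ▸ hy)).mono ball_subset_closedBall) ?_
  refine Filter.Tendsto.congr' (f₁ := fun y ↦ f' y • (1 : ℂ →L[ℝ] ℂ)) ?_ ?_
  · filter_upwards [self_mem_nhdsWithin] with y hy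
    exact (hd y hy).fderiv.symm
  · exact Filter.Tendsto.smul_const ((hf' z hz).mono ball_subset_closedBall) _

/-- A power series with rapidly decaying coefficients is smooth on the closed unit disc. -/
lemma contDiffOn_tsum_mul_pow (ha : ∀ k : ℕ, Summable fun n : ℕ ↦ (n : ℝ) ^ k * ‖a n‖) :
    ContDiffOn ℝ ∞ (fun z ↦ ∑' n, a n * z ^ n) (closedBall (0 : ℂ) 1) := by
  rw [contDiffOn_infty]
  intro m
  induction m generalizing a with
  | zero =>
    exact contDiffOn_zero.2 (continuousOn_tsum_mul_pow (by simpa using ha 0))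
  | succ m ih =>
    have hb : ∀ k : ℕ, Summable fun n : ℕ ↦ (n : ℝ) ^ k * ‖((n + 1 : ℕ) : ℂ) * a (n + 1)‖ :=
      fun k ↦ summable_norm_succ_mul (ha (k + 1))
    have ha0 : Summable fun n ↦ ‖a n‖ := by simpa using ha 0
    have hu : UniqueDiffOn ℝ (closedBall (0 : ℂ) 1) :=
      uniqueDiffOn_convex (convex_closedBall 0 1) (by simp [interior_closedBall])
    rw [Nat.cast_succ, contDiffOn_succ_iff_hasFDerivWithinAt_of_uniqueDiffOn hu]
    refine ⟨by simp, _, (ih hb).smul (contDiffOn_const (c := (1 : ℂ →L[ℝ] ℂ))), fun z hz ↦ ?_⟩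
    exact hasFDerivWithinAt_closedBall_of_continuousOn (continuousOn_tsum_mul_pow ha0)
      (continuousOn_tsum_mul_pow (by simpa using hb 0))
      (fun y hy ↦ hasDerivAt_tsum_mul_pow ha0 (by simpa using ha 1) hy) hz

end PowerSeries

lemma SchwartzMap.summable_pow_mul_norm_natCast (f : 𝓢(ℝ, ℂ)) (k : ℕ) :
    Summable fun n : ℕ ↦ (n : ℝ) ^ k * ‖f n‖ := by
  obtain ⟨C, -, hC⟩ := f.decay (k + 2) 0
  have hs : Summable fun n : ℕ ↦ C * (1 / (n : ℝ) ^ 2) :=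
    (Real.summable_one_div_nat_pow.2 one_lt_two).mul_left C
  refine (summable_nat_add_iff 1).1 <|
    ((summable_nat_add_iff 1).2 hs).of_nonneg_of_le (fun n ↦ by positivity) fun n ↦ ?_
  have h := hC ((n + 1 : ℕ) : ℝ)
  rw [norm_iteratedFDeriv_zero, Real.norm_natCast, pow_add] at h
  rw [mul_one_div, le_div_iff₀ (by positivity)]
  linarith

lemma fourier_neg_eq_conj {f : ℝ → ℂ} (hf : ∀ x, (starRingEnd ℂ) (f x) = f x) (w : ℝ) :
    𝓕 f (-w) = (starRingEnd ℂ) (𝓕 f w) := by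
  rw [Real.fourier_real_eq_integral_exp_smul, Real.fourier_real_eq_integral_exp_smul,
    ← integral_conj]
  congr 1
  ext v
  simp only [smul_eq_mul, map_mul, hf, ← Complex.exp_conj, Complex.conj_I, Complex.conj_ofReal]
  congr 2
  push_cast
  ring

/-- On a proper arc, the angle is the real part of the boundary value of a holomorphic function
with rapidly decaying Taylor coefficients. -/
lemma exists_tsum_re_eq {r : ℝ} (hr : 0 < r) (hr' : r < 1 / 2) :
    ∃ a : ℕ → ℂ, (∀ k : ℕ, Summable fun n : ℕ ↦ (n : ℝ) ^ k * ‖a n‖) ∧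
      ∀ t : ℝ, |t| ≤ r →
        (2 * ∑' n, a n * Complex.exp (2 * Real.pi * t * Complex.I) ^ n - a 0).re = t := by
  let χ : ContDiffBump (0 : ℝ) := ⟨r, 1 / 2, hr, hr'⟩
  have hsupp : HasCompactSupport fun x : ℝ ↦ ((χ x * x : ℝ) : ℂ) :=
    (χ.hasCompactSupport.mul_right (f' := fun x ↦ x)).comp_left Complex.ofReal_zero
  have hsm : ContDiff ℝ ∞ fun x : ℝ ↦ ((χ x * x : ℝ) : ℂ) :=
    Complex.ofRealCLM.contDiff.comp (χ.contDiff.mul contDiff_id)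
  let f : 𝓢(ℝ, ℂ) := hsupp.toSchwartzMap hsm
  have hf : ∀ x, f x = ((χ x * x : ℝ) : ℂ) := fun x ↦ rfl
  have hconj : ∀ w : ℝ, 𝓕 f (-w) = (starRingEnd ℂ) (𝓕 f w) := fun w ↦ by
    simpa only [SchwartzMap.fourier_coe] using
      fourier_neg_eq_conj (f := f) (fun x ↦ by rw [hf, Complex.conj_ofReal]) w
  have hdecay := (𝓕 f).summable_pow_mul_norm_natCast
  refine ⟨fun n ↦ 𝓕 f n, hdecay, fun t ht ↦ ?_⟩
  set e : ℂ := Complex.exp (2 * Real.pi * t * Complex.I) with he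
  have hee : ∀ n : ℤ, fourier n (t : UnitAddCircle) = e ^ n := fun n ↦ by
    rw [fourier_coe_apply, he, ← Complex.exp_int_mul]
    congr 1
    push_cast
    ring
  have hnorm : ‖e‖ = 1 := by
    rw [he, show (2 * Real.pi * t * Complex.I : ℂ) = ((2 * Real.pi * t : ℝ) : ℂ) * Complex.I by
      push_cast; ring, Complex.norm_exp_ofReal_mul_I]
  have hmem : e ∈ closedBall (0 : ℂ) 1 := by simp [hnorm]
  have hsum : Summable fun n : ℕ ↦ 𝓕 f n * e ^ n :=
    Summable.of_norm_bounded (by simpa using hdecay 0) fun n ↦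
      norm_mul_pow_le_of_mem_closedBall _ n hmem
  have hneg : ∀ n : ℕ, 𝓕 f ((-(n : ℤ) : ℤ) : ℝ) * e ^ (-(n : ℤ)) =
      (starRingEnd ℂ) (𝓕 f n * e ^ n) := fun n ↦ by
    rw [Int.cast_neg, Int.cast_natCast, hconj, map_mul, map_pow, zpow_neg, zpow_natCast,
      ← inv_pow, Complex.inv_eq_conj hnorm]
  have hsumneg : Summable fun n : ℕ ↦ 𝓕 f ((-(n : ℤ) : ℤ) : ℝ) * e ^ (-(n : ℤ)) := by
    simp_rw [hneg]
    exact (Complex.hasSum_conj'.2 (by simpa using hsum.hasSum)).summable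
  have hZ : Summable fun n : ℤ ↦ 𝓕 f n * e ^ n :=
    Summable.of_nat_of_neg (by simpa using hsum) hsumneg
  have hpoisson := SchwartzMap.tsum_eq_tsum_fourier f t
  simp_rw [hee] at hpoisson
  rw [tsum_eq_single 0] at hpoisson
  · have hχ : χ t = 1 := χ.one_of_mem_closedBall (by simpa using ht)
    rw [Int.cast_zero, add_zero, hf, hχ, one_mul] at hpoisson
    have h1 := hZ.hasSum.nat_add_neg.tsum_eq
    rw [← hpoisson] at h1
    have h2 : ∀ n : ℕ, 𝓕 f ((n : ℤ) : ℝ) * e ^ (n : ℤ) +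
        𝓕 f ((-(n : ℤ) : ℤ) : ℝ) * e ^ (-(n : ℤ)) =
        ((2 * (𝓕 f n * e ^ n).re : ℝ) : ℂ) := fun n ↦ by
      rw [hneg, Int.cast_natCast, zpow_natCast, Complex.add_conj]
    simp_rw [h2] at h1
    rw [← Complex.ofReal_tsum, tsum_mul_left, ← Complex.re_tsum hsum] at h1
    have h3 := congrArg Complex.re h1
    simp only [Complex.ofReal_re, Complex.add_re, Int.cast_zero, zpow_zero, mul_one] at h3
    simp only [Complex.sub_re, Complex.mul_re, Complex.re_ofNat, Complex.im_ofNat, zero_mul,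
      sub_zero, Nat.cast_zero]
    linarith
  · intro n hn
    have h1 : (1 : ℝ) ≤ |(n : ℝ)| := by exact_mod_cast Int.one_le_abs hn
    have h2 : χ (t + n) = 0 := χ.zero_of_le_dist (by
      rw [Real.dist_eq, sub_zero]
      change 1 / 2 ≤ |t + n|
      have := abs_sub_abs_le_abs_sub (n : ℝ) (-t)
      rw [abs_neg, sub_neg_eq_add, add_comm (n : ℝ)] at this
      linarith)
    rw [hf, h2, zero_mul, Complex.ofReal_zero]

/-- Lemma 6.3, existence part: for every `ε > 0` and `ℓ ∈ ℕ` there is a nonvanishing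
function `h`, holomorphic on the open unit disc and `C^∞` up to the boundary, such that
`ζ^ℓ h(ζ)` is real-valued on the boundary arc `{e^{iθ} : |θ| ≤ π - ε/8}`. -/
theorem stmt_3 (ε : ℝ) (hε : 0 < ε) (ℓ : ℕ) :
    ∃ h : ℂ → ℂ,
      (∀ z ∈ ball (0 : ℂ) 1, DifferentiableAt ℂ h z) ∧
      ContDiffOn ℝ (⊤ : ℕ∞) h (closedBall (0 : ℂ) 1) ∧
      (∀ z ∈ closedBall (0 : ℂ) 1, h z ≠ 0) ∧
      (∀ θ : ℝ, |θ| ≤ Real.pi - ε / 8 →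
        ((Complex.exp (θ * Complex.I)) ^ ℓ *
          h (Complex.exp (θ * Complex.I))).im = 0) := by
  have hπ := Real.pi_gt_three
  obtain ⟨δ, hδ, hδε, hδ1⟩ : ∃ δ : ℝ, 0 < δ ∧ δ ≤ ε / 8 ∧ δ ≤ 1 :=
    ⟨min (ε / 8) 1, by positivity, min_le_left _ _, min_le_right _ _⟩
  obtain ⟨a, ha, hre⟩ := exists_tsum_re_eq (r := (Real.pi - δ) / (2 * Real.pi))
    (div_pos (by linarith) (by positivity)) (by rw [div_lt_div_iff₀] <;> linarith)
  let c : ℂ := -(2 * Real.pi * ℓ * Complex.I)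
  refine ⟨fun z ↦ Complex.exp (c * (2 * ∑' n, a n * z ^ n - a 0)), fun z hz ↦ ?_, ?_,
    fun z _ ↦ Complex.exp_ne_zero _, fun θ hθ ↦ ?_⟩
  · have := (hasDerivAt_tsum_mul_pow (by simpa using ha 0) (by simpa using ha 1)
      hz).differentiableAt
    exact (((this.const_mul 2).sub_const (a 0)).const_mul c).cexp
  · exact (contDiffOn_const.mul
      ((contDiffOn_const.mul (contDiffOn_tsum_mul_pow ha)).sub contDiffOn_const)).cexp
  · have hθ' : |θ / (2 * Real.pi)| ≤ (Real.pi - δ) / (2 * Real.pi) := by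
      rw [abs_div, abs_of_pos (show 0 < 2 * Real.pi by positivity)]
      gcongr
      linarith
    have h := hre _ hθ'
    have he : (2 * Real.pi * ((θ / (2 * Real.pi) : ℝ) : ℂ) * Complex.I) = θ * Complex.I := by
      have : (Real.pi : ℂ) ≠ 0 := by exact_mod_cast Real.pi_ne_zero
      push_cast
      field_simp
    rw [he] at h
    simp only
    generalize 2 * ∑' n, a n * Complex.exp (θ * Complex.I) ^ n - a 0 = w at h ⊢
    rw [← Complex.exp_nat_mul, ← Complex.exp_add, Complex.exp_im]
    have him : (ℓ * (θ * Complex.I) + c * w).im = 0 := by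
      simp only [c, Complex.add_im, Complex.mul_im, Complex.neg_im, Complex.neg_re,
        Complex.mul_re, Complex.I_re, Complex.I_im, Complex.ofReal_re, Complex.ofReal_im,
        Complex.natCast_re, Complex.natCast_im, Complex.re_ofNat, Complex.im_ofNat, h]
      field_simp
      ring
    rw [him, Real.sin_zero, mul_zero]
end

section
/- For every C^∞ function v : ℝ → ℝ satisfying v(θ + 2π) = v(θ) for all θ ∈ ℝ, there exists a function F : ℂ → ℂ such that: F is complex-differentiable at every point of the open unit disc; the restriction of F to the closed unit disc is C^∞ in the real sense; Re F(0) = 0; and Im F(e^{iθ}) = v(θ) for all θ ∈ ℝ. -/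
open Metric

/-- Second-order Taylor estimate for `z ↦ z ^ n` on the closed unit disc. -/
theorem norm_pow_sub_pow_sub_mul_le {z w : ℂ} (hz : ‖z‖ ≤ 1) (hw : ‖w‖ ≤ 1) (n : ℕ) :
    ‖z ^ n - w ^ n - (z - w) * (n * w ^ (n - 1))‖ ≤ (n : ℝ) ^ 2 * ‖z - w‖ ^ 2 := by
  have hpow (k : ℕ) : ‖z ^ k - w ^ k‖ ≤ k * ‖z - w‖ := by
    induction k with
    | zero => simp
    | succ k ih =>
      have h : z ^ (k + 1) - w ^ (k + 1) = z ^ k * (z - w) + (z ^ k - w ^ k) * w := by ring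
      rw [h]
      have h₁ : ‖z ^ k * (z - w)‖ ≤ 1 * ‖z - w‖ := by
        rw [norm_mul, norm_pow]
        gcongr
        exact pow_le_one₀ (norm_nonneg _) hz
      have h₂ : ‖(z ^ k - w ^ k) * w‖ ≤ k * ‖z - w‖ * 1 := by
        rw [norm_mul]
        gcongr
      refine (norm_add_le _ _).trans ?_
      push_cast
      linarith
  induction n with
  | zero => simp
  | succ n ih =>
    have h : z ^ (n + 1) - w ^ (n + 1) - (z - w) * ((n + 1 : ℕ) * w ^ (n + 1 - 1)) =
        w * (z ^ n - w ^ n - (z - w) * (n * w ^ (n - 1))) + (z ^ n - w ^ n) * (z - w) := by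
      cases n with
      | zero => simp
      | succ n =>
        simp only [Nat.add_sub_cancel]
        push_cast
        ring
    rw [h]
    have h₁ : ‖w * (z ^ n - w ^ n - (z - w) * (n * w ^ (n - 1)))‖ ≤
        1 * ((n : ℝ) ^ 2 * ‖z - w‖ ^ 2) := by
      rw [norm_mul]
      gcongr
    have h₂ : ‖(z ^ n - w ^ n) * (z - w)‖ ≤ n * ‖z - w‖ * ‖z - w‖ := by
      rw [norm_mul]
      gcongr
      exact hpow n
    refine (norm_add_le _ _).trans ?_
    push_cast
    nlinarith [sq_nonneg ‖z - w‖, (n.cast_nonneg : (0 : ℝ) ≤ n)]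

theorem summable_mul_pow_of_norm_le_one {c : ℕ → ℂ} (hc : Summable fun n ↦ ‖c n‖) {z : ℂ}
    (hz : ‖z‖ ≤ 1) : Summable fun n ↦ c n * z ^ n := by
  refine Summable.of_norm_bounded hc fun n ↦ ?_
  rw [norm_mul, norm_pow]
  exact mul_le_of_le_one_right (norm_nonneg _) (pow_le_one₀ (norm_nonneg _) hz)

/-- Termwise differentiation of a power series up to the boundary of the unit disc. -/
theorem hasDerivWithinAt_tsum_pow_closedBall {c : ℕ → ℂ}
    (h₀ : Summable fun n ↦ ‖c n‖)
    (h₁ : Summable fun n : ℕ ↦ ‖((n + 1 : ℕ) : ℂ) * c (n + 1)‖)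
    (h₂ : Summable fun n : ℕ ↦ (n : ℝ) ^ 2 * ‖c n‖) {z : ℂ} (hz : z ∈ closedBall (0 : ℂ) 1) :
    HasDerivWithinAt (fun w ↦ ∑' n, c n * w ^ n)
      (∑' n : ℕ, ((n + 1 : ℕ) : ℂ) * c (n + 1) * z ^ n) (closedBall 0 1) z := by
  rw [mem_closedBall_zero_iff] at hz
  rw [hasDerivWithinAt_iff_isLittleO]
  refine Asymptotics.IsBigO.trans_isLittleO (g := fun w ↦ ‖w - z‖ ^ 2) ?_ ?_
  · refine Asymptotics.IsBigO.of_bound (∑' n : ℕ, (n : ℝ) ^ 2 * ‖c n‖) ?_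
    filter_upwards [self_mem_nhdsWithin] with w hw
    rw [mem_closedBall_zero_iff] at hw
    have hd : HasSum (fun n : ℕ ↦ c n * (n * z ^ (n - 1)))
        (∑' n : ℕ, ((n + 1 : ℕ) : ℂ) * c (n + 1) * z ^ n) := by
      rw [← hasSum_nat_add_iff' 1]
      simp only [Nat.add_sub_cancel, Finset.sum_range_one, Nat.cast_zero, zero_mul, mul_zero,
        sub_zero]
      refine (summable_mul_pow_of_norm_le_one h₁ hz).hasSum.congr_fun fun n ↦ ?_
      ring
    have hs := ((summable_mul_pow_of_norm_le_one h₀ hw).hasSum.sub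
      (summable_mul_pow_of_norm_le_one h₀ hz).hasSum).sub (hd.mul_left (w - z))
    rw [smul_eq_mul, ← hs.tsum_eq, norm_pow, norm_norm, ← tsum_mul_right]
    refine tsum_of_norm_bounded (h₂.mul_right _).hasSum fun n ↦ ?_
    have h : c n * w ^ n - c n * z ^ n - (w - z) * (c n * (n * z ^ (n - 1))) =
        c n * (w ^ n - z ^ n - (w - z) * (n * z ^ (n - 1))) := by ring
    rw [h, norm_mul]
    calc ‖c n‖ * ‖w ^ n - z ^ n - (w - z) * (n * z ^ (n - 1))‖
        ≤ ‖c n‖ * ((n : ℝ) ^ 2 * ‖w - z‖ ^ 2) := by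
          gcongr
          exact norm_pow_sub_pow_sub_mul_le hw hz n
      _ = _ := by ring
  · have h := (Asymptotics.isLittleO_pow_sub_sub z (one_lt_two)).mono
      (nhdsWithin_le_nhds (s := closedBall (0 : ℂ) 1))
    simpa using h

/-- A power series with rapidly decreasing coefficients is smooth on the closed unit disc. -/
theorem contDiffOn_tsum_pow_closedBall {c : ℕ → ℂ}
    (hc : ∀ k : ℕ, Summable fun n : ℕ ↦ (n : ℝ) ^ k * ‖c n‖) :
    ContDiffOn ℂ (⊤ : ℕ∞) (fun z ↦ ∑' n, c n * z ^ n) (closedBall 0 1) := by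
  have hu : UniqueDiffOn ℂ (closedBall (0 : ℂ) 1) := fun z hz ↦
    (uniqueDiffOn_convex (convex_closedBall (0 : ℂ) 1)
      ⟨0, ball_subset_interior_closedBall (mem_ball_self one_pos)⟩ z hz).mono_field
  rw [contDiffOn_infty]
  intro m
  induction m generalizing c with
  | zero =>
    exact contDiffOn_zero.2 (continuousOn_tsum (fun n ↦ by fun_prop) (by simpa using hc 0)
      fun n z hz ↦ by
        rw [norm_mul, norm_pow]
        exact mul_le_of_le_one_right (norm_nonneg _)
          (pow_le_one₀ (norm_nonneg _) (mem_closedBall_zero_iff.1 hz)))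
  | succ m ih =>
    have hc' (k : ℕ) : Summable fun n : ℕ ↦ (n : ℝ) ^ k * ‖((n + 1 : ℕ) : ℂ) * c (n + 1)‖ := by
      refine Summable.of_nonneg_of_le (fun n ↦ by positivity) (fun n ↦ ?_)
        ((summable_nat_add_iff 1).2 (hc (k + 1)))
      rw [norm_mul, Complex.norm_natCast, ← mul_assoc, pow_succ]
      gcongr
      simp
    have hd (z : ℂ) (hz : z ∈ closedBall (0 : ℂ) 1) :=
      hasDerivWithinAt_tsum_pow_closedBall (by simpa using hc 0) (by simpa using hc' 0) (hc 2) hz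
    rw [Nat.cast_succ, contDiffOn_succ_iff_derivWithin hu]
    refine ⟨fun z hz ↦ (hd z hz).differentiableWithinAt, by simp, ?_⟩
    exact (ih hc').congr fun z hz ↦ (hd z hz).derivWithin (hu z hz)

/-- The Fourier coefficients of a `C^k` periodic function are `O(|n|⁻ᵏ)`. -/
theorem exists_norm_fourierCoeffOn_le {T : ℝ} (hT : 0 < T) (a : ℝ) (k : ℕ) {f : ℝ → ℂ}
    (hf : ContDiff ℝ k f) (hper : Function.Periodic f T) :
    ∃ C : ℝ, ∀ n : ℤ, n ≠ 0 →
      ‖fourierCoeffOn (lt_add_of_pos_right a hT) f n‖ ≤ C * (1 / |(n : ℝ)| ^ k) := by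
  induction k generalizing f with
  | zero =>
    obtain ⟨C, hC⟩ := isCompact_Icc.exists_bound_of_continuousOn (s := Set.Icc a (a + T))
      hf.continuous.continuousOn
    refine ⟨|1 / (a + T - a)| * (C * |a + T - a|), fun n _ ↦ ?_⟩
    rw [fourierCoeffOn_eq_integral, norm_smul, pow_zero, div_one, mul_one, Real.norm_eq_abs]
    gcongr
    refine intervalIntegral.norm_integral_le_of_norm_le_const fun x hx ↦ ?_
    rw [Set.uIoc_of_le (by linarith)] at hx
    rw [norm_smul, fourier_apply, Circle.norm_coe, one_mul]
    exact hC x (Set.Ioc_subset_Icc_self hx)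
  | succ k ih =>
    rw [Nat.cast_succ, contDiff_succ_iff_deriv] at hf
    have hper' : Function.Periodic (deriv f) T := fun x ↦ by
      rw [← deriv_comp_add_const, funext hper]
    obtain ⟨C, hC⟩ := ih hf.2.2 hper'
    refine ⟨T / (2 * Real.pi) * C, fun n hn ↦ ?_⟩
    rw [fourierCoeffOn_of_hasDerivAt _ hn (fun x _ ↦ (hf.1 x).hasDerivAt)
      (hf.2.2.continuous.intervalIntegrable _ _), hper a, sub_self, mul_zero, zero_sub,
      norm_mul, norm_neg, norm_mul]
    have h₁ : ‖1 / (-2 * (Real.pi : ℂ) * Complex.I * n)‖ = 1 / (2 * Real.pi * |(n : ℝ)|) := by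
      simp [abs_of_pos Real.pi_pos]
    have h₂ : ‖((a + T : ℝ) : ℂ) - a‖ = T := by
      rw [← Complex.ofReal_sub, add_sub_cancel_left, Complex.norm_real, Real.norm_eq_abs,
        abs_of_pos hT]
    have hn' : 0 < |(n : ℝ)| := by positivity
    rw [h₁, h₂]
    calc _ ≤ 1 / (2 * Real.pi * |(n : ℝ)|) * (T * (C * (1 / |(n : ℝ)| ^ k))) := by
          gcongr
          exact hC n hn
      _ = _ := by
          field_simp
          ring

theorem fourierCoeff_lift_eq_fourierCoeffOn {T : ℝ} [hT : Fact (0 < T)] (a : ℝ) {f : ℝ → ℂ}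
    (hper : Function.Periodic f T) (n : ℤ) :
    fourierCoeff (T := T) hper.lift n = fourierCoeffOn (lt_add_of_pos_right a hT.out) f n := by
  rw [fourierCoeffOn_eq_integral, fourierCoeff_eq_intervalIntegral _ _ a, add_sub_cancel_left a T]
  rfl

theorem fourierCoeff_neg_of_conj_eq {T : ℝ} [Fact (0 < T)] {f : AddCircle T → ℂ}
    (hf : ∀ x, starRingEnd ℂ (f x) = f x) (n : ℤ) :
    fourierCoeff f (-n) = starRingEnd ℂ (fourierCoeff f n) := by
  rw [fourierCoeff, fourierCoeff, ← integral_conj]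
  refine MeasureTheory.integral_congr_ae (.of_forall fun x ↦ ?_)
  simp only [smul_eq_mul, map_mul, hf, fourier_neg, neg_neg, Complex.conj_conj]

/-- Fourier coefficients of a smooth periodic function are rapidly decreasing. -/
theorem summable_pow_mul_norm_fourierCoeff {T : ℝ} [hT : Fact (0 < T)] {f : ℝ → ℂ}
    (hf : ContDiff ℝ (⊤ : ℕ∞) f) (hper : Function.Periodic f T) (k : ℕ) :
    Summable fun n : ℤ ↦ |(n : ℝ)| ^ k * ‖fourierCoeff (T := T) hper.lift n‖ := by
  obtain ⟨C, hC⟩ := exists_norm_fourierCoeffOn_le hT.out 0 (k + 2) (contDiff_infty.1 hf _) hper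
  refine Summable.of_norm_bounded_eventually
    ((Real.summable_one_div_int_pow.2 one_lt_two).mul_left C) ?_
  filter_upwards [(Set.finite_singleton (0 : ℤ)).compl_mem_cofinite] with n hn
  replace hn : n ≠ 0 := hn
  have hn' : 0 < |(n : ℝ)| := by positivity
  rw [fourierCoeff_lift_eq_fourierCoeffOn 0, norm_mul, norm_norm, norm_pow, Real.norm_eq_abs,
    abs_abs]
  calc _ ≤ |(n : ℝ)| ^ k * (C * (1 / |(n : ℝ)| ^ (k + 2))) := by
        gcongr
        exact hC n hn
    _ = _ := by
        rw [← sq_abs (n : ℝ)]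
        field_simp
        ring

/-- The analytic ingredient of Lemma 6.3: every smooth `2π`-periodic `v : ℝ → ℝ` is the
boundary imaginary part of a function `F` holomorphic on the open unit disc, `C^∞` up to
the boundary, and normalized by `Re F(0) = 0` (i.e. `F = -T₀v + iv` with `T₀` the
harmonic conjugation operator). -/
theorem stmt_5 (v : ℝ → ℝ) (hv : ContDiff ℝ (⊤ : ℕ∞) v)
    (hper : ∀ θ : ℝ, v (θ + 2 * Real.pi) = v θ) :
    ∃ F : ℂ → ℂ,
      (∀ z ∈ ball (0 : ℂ) 1, DifferentiableAt ℂ F z) ∧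
      ContDiffOn ℝ (⊤ : ℕ∞) F (closedBall (0 : ℂ) 1) ∧
      (F 0).re = 0 ∧
      ∀ θ : ℝ, (F (Complex.exp (θ * Complex.I))).im = v θ := by
  have : Fact (0 < 2 * Real.pi) := ⟨Real.two_pi_pos⟩
  set f : ℝ → ℂ := fun θ ↦ (v θ : ℂ) with hf_def
  have hf : ContDiff ℝ (⊤ : ℕ∞) f := Complex.ofRealCLM.contDiff.comp hv
  have hfper : Function.Periodic f (2 * Real.pi) := fun θ ↦ by simp only [hf_def, hper]
  set g : AddCircle (2 * Real.pi) → ℂ := hfper.lift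
  have hg_coe (θ : ℝ) : g θ = v θ := rfl
  have hg_cont : Continuous g := continuous_coinduced_dom.2 hf.continuous
  have hg_conj (x : AddCircle (2 * Real.pi)) : starRingEnd ℂ (g x) = g x := by
    induction x using QuotientAddGroup.induction_on with
    | H θ => exact Complex.conj_ofReal _
  set c : ℤ → ℂ := fourierCoeff g
  have hc (k : ℕ) : Summable fun n : ℤ ↦ |(n : ℝ)| ^ k * ‖c n‖ :=
    summable_pow_mul_norm_fourierCoeff hf hfper k
  have hc_nat (k : ℕ) : Summable fun n : ℕ ↦ (n : ℝ) ^ k * ‖c n‖ := by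
    simpa [Function.comp_def] using (hc k).comp_injective Nat.cast_injective
  have hc_neg (n : ℤ) : c (-n) = starRingEnd ℂ (c n) := fourierCoeff_neg_of_conj_eq hg_conj n
  have hc_zero : (c 0).im = 0 := Complex.conj_eq_iff_im.1 (by simpa using (hc_neg 0).symm)
  have hS := contDiffOn_tsum_pow_closedBall (c := fun n : ℕ ↦ c n) hc_nat
  set S : ℂ → ℂ := fun z ↦ ∑' n : ℕ, c n * z ^ n with hS_def
  have hS_zero : S 0 = c 0 := by
    simp only [hS_def]
    rw [tsum_eq_single 0 fun n hn ↦ by simp [hn]]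
    simp
  have hF : ContDiffOn ℂ (⊤ : ℕ∞) (fun z ↦ Complex.I * (2 * S z - c 0)) (closedBall 0 1) :=
    contDiffOn_const.mul ((contDiffOn_const.mul hS).sub contDiffOn_const)
  refine ⟨fun z ↦ Complex.I * (2 * S z - c 0), fun z hz ↦ ?_, hF.restrict_scalars ℝ, ?_,
    fun θ ↦ ?_⟩
  · exact (hF.differentiableOn (by simp)).differentiableAt (closedBall_mem_nhds_of_mem hz)
  · simp [hS_zero, hc_zero]
  · have hsum : Summable (fourierCoeff (⟨g, hg_cont⟩ : C(AddCircle (2 * Real.pi), ℂ))) :=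
      Summable.of_norm (by simpa using hc 0)
    have h := (has_pointwise_sum_fourier_series_of_summable hsum (θ : AddCircle _)).nat_add_neg
    have hterm (n : ℕ) : fourier (T := 2 * Real.pi) n (θ : AddCircle _) =
        Complex.exp (θ * Complex.I) ^ n := by
      have hpi : (Real.pi : ℂ) ≠ 0 := by exact_mod_cast Real.pi_ne_zero
      rw [fourier_coe_apply, ← Complex.exp_nat_mul]
      congr 1
      push_cast
      field_simp
    have hS_sum : HasSum (fun n : ℕ ↦ c n * Complex.exp (θ * Complex.I) ^ n)
        (S (Complex.exp (θ * Complex.I))) :=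
      (summable_mul_pow_of_norm_le_one (by simpa using hc_nat 0)
        (Complex.norm_exp_ofReal_mul_I θ).le).hasSum
    have hre : HasSum (fun n : ℕ ↦ 2 * (c n * Complex.exp (θ * Complex.I) ^ n).re)
        (v θ + (c 0).re) := by
      convert Complex.hasSum_re h using 1
      · ext n
        change _ = (c n • fourier n (θ : AddCircle (2 * Real.pi)) +
          c (-n) • fourier (-n) (θ : AddCircle (2 * Real.pi))).re
        rw [hc_neg, fourier_neg, hterm, smul_eq_mul, smul_eq_mul, ← map_mul, Complex.add_re,
          Complex.conj_re, two_mul]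
      · change _ = (g θ + c 0 • fourier 0 (θ : AddCircle (2 * Real.pi))).re
        simp [hg_coe]
    have heq := ((Complex.hasSum_re hS_sum).mul_left 2).unique hre
    simp [heq]
end

section
/- Let N ≥ 1 be an integer, let Ω₀ ⊆ ℝ^N be an open neighborhood of 0, and let φ : Ω₀ → ℝ^N be real-analytic with φ(0) = 0 and Dφ(0) = 0, so that R = {x + iφ(x) : x ∈ Ω₀} ⊆ ℂ^N is a real-analytic maximally real submanifold through 0 given in graph form. Let ε > 0 and let x : (−ε, ε) → Ω₀ be a real-analytic curve with x(0) = 0, and set γ(s) := x(s) + i φ(x(s)). Then, after possibly shrinking ε > 0, there exist an open ball B ⊆ ℂ^N centered at 0 with γ((−ε, ε)) ⊆ B and C^∞ functions r_j : (−ε, ε) × B → ℝ, j = 1, …, N, such that: (1) r_j(s, γ(s)) = 0 for all s ∈ (−ε, ε) and all j; (2) for every s with ε/2 ≤ |s| < ε and every z = x + iy ∈ B one has r_j(s, z) = y_j − φ_j(x), the defining functions of R; (3) for every s with |s| ≤ ε/4, the common zero set {z ∈ B : r_1(s, z) = ⋯ = r_N(s, z) = 0} equals B ∩ {x + iy ∈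 ℂ^N : y_j = φ_j(x(s)) + Σ_{k=1}^{N} (∂φ_j/∂x_k)(x(s)) · (x_k − x_k(s)) for j = 1, …, N}, i.e. the intersection of B with the affine tangent space to R at γ(s). -/
open Metric

/-- The point `x + iy ∈ ℂ^N` with real part `x` and imaginary part `y`. -/
noncomputable def cplxOf {N : ℕ} (x y : EuclideanSpace ℝ (Fin N)) :
    EuclideanSpace ℂ (Fin N) :=
  (WithLp.equiv 2 (Fin N → ℂ)).symm fun j => (x j : ℂ) + y j * Complex.I

/-- The real part `x` of a point `z = x + iy ∈ ℂ^N`. -/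
noncomputable def rePart {N : ℕ} (z : EuclideanSpace ℂ (Fin N)) :
    EuclideanSpace ℝ (Fin N) :=
  (WithLp.equiv 2 (Fin N → ℝ)).symm fun j => (z j).re

/-- The imaginary part `y` of a point `z = x + iy ∈ ℂ^N`. -/
noncomputable def imPart {N : ℕ} (z : EuclideanSpace ℂ (Fin N)) :
    EuclideanSpace ℝ (Fin N) :=
  (WithLp.equiv 2 (Fin N → ℝ)).symm fun j => (z j).im

theorem rePart_cplxOf {N : ℕ} (x y : EuclideanSpace ℝ (Fin N)) : rePart (cplxOf x y) = x := by
  ext j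
  simp [rePart, cplxOf]

theorem imPart_cplxOf {N : ℕ} (x y : EuclideanSpace ℝ (Fin N)) : imPart (cplxOf x y) = y := by
  ext j
  simp [imPart, cplxOf]

theorem contDiff_rePart {N : ℕ} {n : WithTop ℕ∞} :
    ContDiff ℝ n (rePart : EuclideanSpace ℂ (Fin N) → EuclideanSpace ℝ (Fin N)) := by
  rw [contDiff_euclidean]
  intro j
  exact (Complex.reCLM.comp
    ((EuclideanSpace.proj j : EuclideanSpace ℂ (Fin N) →L[ℂ] ℂ).restrictScalars ℝ)).contDiff

theorem contDiff_imPart {N : ℕ} {n : WithTop ℕ∞} :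
    ContDiff ℝ n (imPart : EuclideanSpace ℂ (Fin N) → EuclideanSpace ℝ (Fin N)) := by
  rw [contDiff_euclidean]
  intro j
  exact (Complex.imCLM.comp
    ((EuclideanSpace.proj j : EuclideanSpace ℂ (Fin N) →L[ℂ] ℂ).restrictScalars ℝ)).contDiff

theorem continuous_cplxOf {N : ℕ} :
    Continuous fun p : EuclideanSpace ℝ (Fin N) × EuclideanSpace ℝ (Fin N) =>
      cplxOf p.1 p.2 := by
  refine (PiLp.continuous_toLp 2 _).comp (continuous_pi fun j => ?_)
  fun_prop

/-- Lemma 6.2: a real-analytic maximally real submanifold `R = {x + iφ(x)}` of `ℂ^N`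
can be glued smoothly, along a real-analytic curve `γ(s) = x(s) + iφ(x(s))` in it, with
the family of its affine tangent spaces at the points of the curve: there are smooth
defining functions `r_j(s, z)` vanishing along `γ`, equal to the defining functions
`y_j - φ_j(x)` of `R` for `ε/2 ≤ |s|`, and cutting out the affine tangent space of `R`
at `γ(s)` for `|s| ≤ ε/4`. -/
theorem stmt_6 (N : ℕ) (hN : 1 ≤ N)
    (Ω₀ : Set (EuclideanSpace ℝ (Fin N))) (hΩo : IsOpen Ω₀) (hΩ0 : 0 ∈ Ω₀)
    (φ : EuclideanSpace ℝ (Fin N) → EuclideanSpace ℝ (Fin N))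
    (hφan : AnalyticOnNhd ℝ φ Ω₀) (hφ0 : φ 0 = 0) (hdφ0 : fderiv ℝ φ 0 = 0)
    (ε : ℝ) (hε : 0 < ε)
    (x : ℝ → EuclideanSpace ℝ (Fin N)) (hxan : AnalyticOnNhd ℝ x (Set.Ioo (-ε) ε))
    (hx0 : x 0 = 0) (hxΩ : ∀ s ∈ Set.Ioo (-ε) ε, x s ∈ Ω₀) :
    ∃ ε' : ℝ, 0 < ε' ∧ ε' ≤ ε ∧
    ∃ ρ : ℝ, 0 < ρ ∧
    ∃ r : Fin N → ℝ → EuclideanSpace ℂ (Fin N) → ℝ,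
      -- the curve γ stays in the ball B = ball 0 ρ, and real parts of points of B
      -- stay in the domain of φ
      (∀ s ∈ Set.Ioo (-ε') ε',
        cplxOf (x s) (φ (x s)) ∈ ball (0 : EuclideanSpace ℂ (Fin N)) ρ) ∧
      (∀ z ∈ ball (0 : EuclideanSpace ℂ (Fin N)) ρ, rePart z ∈ Ω₀) ∧
      -- the r_j are C^∞ on (-ε', ε') × B
      (∀ j : Fin N, ContDiffOn ℝ (⊤ : ℕ∞)
        (fun p : ℝ × EuclideanSpace ℂ (Fin N) => r j p.1 p.2)
        (Set.Ioo (-ε') ε' ×ˢ ball (0 : EuclideanSpace ℂ (Fin N)) ρ)) ∧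
      -- (1) r_j(s, γ(s)) = 0
      (∀ j : Fin N, ∀ s ∈ Set.Ioo (-ε') ε', r j s (cplxOf (x s) (φ (x s))) = 0) ∧
      -- (2) for ε'/2 ≤ |s|, the r_j are the defining functions of R
      (∀ j : Fin N, ∀ s ∈ Set.Ioo (-ε') ε', ε' / 2 ≤ |s| →
        ∀ z ∈ ball (0 : EuclideanSpace ℂ (Fin N)) ρ,
          r j s z = imPart z j - φ (rePart z) j) ∧
      -- (3) for |s| ≤ ε'/4, the zero set of the r_j(s, ·) in B is the intersection of
      -- B with the affine tangent space to R at γ(s)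
      (∀ s ∈ Set.Ioo (-ε') ε', |s| ≤ ε' / 4 →
        {z ∈ ball (0 : EuclideanSpace ℂ (Fin N)) ρ | ∀ j : Fin N, r j s z = 0} =
        {z ∈ ball (0 : EuclideanSpace ℂ (Fin N)) ρ | ∀ j : Fin N,
          imPart z j = φ (x s) j + (fderiv ℝ φ (x s)) (rePart z - x s) j}) := by
  have hre0 : rePart (0 : EuclideanSpace ℂ (Fin N)) = 0 := by
    ext j
    simp [rePart]
  obtain ⟨ρ, hρ, hball⟩ : ∃ ρ > 0, ball (0 : EuclideanSpace ℂ (Fin N)) ρ ⊆ rePart ⁻¹' Ω₀ := by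
    refine Metric.isOpen_iff.1 (hΩo.preimage (contDiff_rePart (n := 0)).continuous) 0 ?_
    simpa [hre0] using hΩ0
  have hxc : ContinuousAt x 0 := (hxan 0 ⟨by linarith, hε⟩).continuousAt
  have hφc : ContinuousAt (fun s => φ (x s)) 0 :=
    ContinuousAt.comp (g := φ) (by rw [hx0]; exact (hφan 0 hΩ0).continuousAt) hxc
  have hγc : ContinuousAt (fun s => cplxOf (x s) (φ (x s))) 0 :=
    continuous_cplxOf.continuousAt.comp (hxc.prodMk hφc)
  have hγ0 : cplxOf (x 0) (φ (x 0)) = 0 := by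
    ext j
    simp [hx0, hφ0, cplxOf]
  obtain ⟨δ, hδ, hγ⟩ := Metric.continuousAt_iff.1 hγc ρ hρ
  obtain ⟨ε', hε', hε'ε, hε'δ⟩ : ∃ ε' : ℝ, 0 < ε' ∧ ε' ≤ ε ∧ ε' ≤ δ :=
    ⟨min ε δ, lt_min hε hδ, min_le_left _ _, min_le_right _ _⟩
  have hsub : Set.Ioo (-ε') ε' ⊆ Set.Ioo (-ε) ε :=
    Set.Ioo_subset_Ioo (neg_le_neg hε'ε) hε'ε
  let χ : ContDiffBump (0 : ℝ) := ⟨ε' / 4, ε' / 2, by linarith, by linarith⟩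
  have hin {s : ℝ} (hs : |s| ≤ ε' / 4) : χ s = 1 :=
    χ.one_of_mem_closedBall (by simpa [χ] using hs)
  have hout {s : ℝ} (hs : ε' / 2 ≤ |s|) : χ s = 0 :=
    χ.zero_of_le_dist (by simpa [χ] using hs)
  refine ⟨ε', hε', hε'ε, ρ, hρ, fun j s z => imPart z j -
    (χ s * (φ (x s) + fderiv ℝ φ (x s) (rePart z - x s)) j + (1 - χ s) * φ (rePart z) j),
    ?_, fun z hz => hball hz, ?_, ?_, ?_, ?_⟩
  · intro s hs
    have h := hγ (x := s) (by
      rw [Real.dist_eq, sub_zero]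
      exact (abs_lt.2 hs).trans_le hε'δ)
    rwa [hγ0] at h
  · intro j
    have hfst : ContDiffOn ℝ (⊤ : ℕ∞) (fun p : ℝ × EuclideanSpace ℂ (Fin N) => p.1)
        (Set.Ioo (-ε') ε' ×ˢ ball 0 ρ) := contDiffOn_fst
    have hre : ContDiffOn ℝ (⊤ : ℕ∞) (fun p : ℝ × EuclideanSpace ℂ (Fin N) => rePart p.2)
        (Set.Ioo (-ε') ε' ×ˢ ball 0 ρ) := contDiff_rePart.comp_contDiffOn contDiffOn_snd
    have him : ContDiffOn ℝ (⊤ : ℕ∞) (fun p : ℝ × EuclideanSpace ℂ (Fin N) => imPart p.2)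
        (Set.Ioo (-ε') ε' ×ˢ ball 0 ρ) := contDiff_imPart.comp_contDiffOn contDiffOn_snd
    have hχ : ContDiffOn ℝ (⊤ : ℕ∞) (fun p : ℝ × EuclideanSpace ℂ (Fin N) => χ p.1)
        (Set.Ioo (-ε') ε' ×ˢ ball 0 ρ) := χ.contDiff.comp_contDiffOn hfst
    have hx : ContDiffOn ℝ (⊤ : ℕ∞) (fun p : ℝ × EuclideanSpace ℂ (Fin N) => x p.1)
        (Set.Ioo (-ε') ε' ×ˢ ball 0 ρ) :=
      (hxan.contDiffOn (uniqueDiffOn_Ioo _ _)).comp hfst fun p hp => hsub hp.1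
    have hφx : ContDiffOn ℝ (⊤ : ℕ∞) (fun p : ℝ × EuclideanSpace ℂ (Fin N) => φ (x p.1))
        (Set.Ioo (-ε') ε' ×ˢ ball 0 ρ) :=
      (hφan.contDiffOn hΩo.uniqueDiffOn).comp hx fun p hp => hxΩ _ (hsub hp.1)
    have hdφ : ContDiffOn ℝ (⊤ : ℕ∞)
        (fun p : ℝ × EuclideanSpace ℂ (Fin N) => fderiv ℝ φ (x p.1))
        (Set.Ioo (-ε') ε' ×ˢ ball 0 ρ) :=
      (hφan.fderiv.contDiffOn hΩo.uniqueDiffOn).comp hx fun p hp => hxΩ _ (hsub hp.1)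
    have hφre : ContDiffOn ℝ (⊤ : ℕ∞)
        (fun p : ℝ × EuclideanSpace ℂ (Fin N) => φ (rePart p.2))
        (Set.Ioo (-ε') ε' ×ˢ ball 0 ρ) :=
      (hφan.contDiffOn hΩo.uniqueDiffOn).comp hre fun p hp => hball hp.2
    have hT := hφx.add (hdφ.clm_apply (hre.sub hx))
    exact (contDiffOn_euclidean.1 him j).sub ((hχ.mul (contDiffOn_euclidean.1 hT j)).add
      ((contDiffOn_const.sub hχ).mul (contDiffOn_euclidean.1 hφre j)))
  · intro j s _
    simp only [rePart_cplxOf, imPart_cplxOf, sub_self, map_zero, add_zero]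
    ring
  · intro j s _ hs z _
    simp [hout hs]
  · intro s _ hs
    ext z
    simp [hin hs, sub_eq_zero]
end

section
/- Let d ≥ 1 be an integer, let Ω ⊆ ℝ^d be open and connected, and let S ⊆ Ω be relatively closed in Ω with μH[d−1](S) = 0. Then Ω \ S is connected. -/
open MeasureTheory

/-- In a finite-dimensional space of dimension `d`, if `S` is `μH[d-1]`-null, then every nonempty
open set meets a line with prescribed direction that avoids `S`. -/
theorem exists_mem_line_avoiding_of_hausdorffMeasure_eq_zero {E : Type*} [NormedAddCommGroup E]
    [NormedSpace ℝ E] [FiniteDimensional ℝ E] [MeasurableSpace E] [BorelSpace E]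
    {S : Set E} (hS : μH[(Module.finrank ℝ E : ℝ) - 1] S = 0)
    {v : E} (hv : v ≠ 0) {U : Set E} (hU : IsOpen U) (hne : U.Nonempty) :
    ∃ w ∈ U, ∀ t : ℝ, w + t • v ∉ S := by
  have hpos : 1 ≤ Module.finrank ℝ E := by
    have : Nontrivial E := ⟨v, 0, hv⟩
    exact Module.finrank_pos
  have hrank : Module.finrank ℝ (E ⧸ (ℝ ∙ v)) =
      Module.finrank ℝ (Fin (Module.finrank ℝ E - 1) → ℝ) := by
    have h₁ := Submodule.finrank_quotient_add_finrank (ℝ ∙ v)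
    have h₂ : Module.finrank ℝ (ℝ ∙ v) = 1 := finrank_span_singleton hv
    rw [Module.finrank_fin_fun]
    omega
  let L : E →L[ℝ] (Fin (Module.finrank ℝ E - 1) → ℝ) := LinearMap.toContinuousLinearMap
    ((LinearEquiv.ofFinrankEq _ _ hrank).toLinearMap ∘ₗ (ℝ ∙ v).mkQ)
  have hsurj : Function.Surjective L :=
    (LinearEquiv.ofFinrankEq _ _ hrank).surjective.comp (Submodule.mkQ_surjective _)
  have hLv : L v = 0 := by
    have : (ℝ ∙ v).mkQ v = 0 := by simp
    change (LinearEquiv.ofFinrankEq _ _ hrank) ((ℝ ∙ v).mkQ v) = 0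
    rw [this, map_zero]
  have hnull : volume (L '' S) = 0 := by
    have hcast : (Module.finrank ℝ E : ℝ) - 1 =
        (Fintype.card (Fin (Module.finrank ℝ E - 1)) : ℝ) := by
      rw [Fintype.card_fin]; push_cast [hpos]; rfl
    rw [← hausdorffMeasure_pi_real, ← hcast]
    have h := L.lipschitz.hausdorffMeasure_image_le (d := (Module.finrank ℝ E : ℝ) - 1)
      (by rw [hcast]; positivity) S
    rw [hS, mul_zero] at h
    exact le_antisymm h bot_le
  have hopen : IsOpen (L '' U) := L.isOpenMap hsurj U hU
  have hnot : ¬ L '' U ⊆ L '' S := fun hsub =>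
    (hopen.measure_pos volume (hne.image L)).ne' (measure_mono_null hsub hnull)
  obtain ⟨_, ⟨w, hwU, rfl⟩, hw⟩ := Set.not_subset.1 hnot
  refine ⟨w, hwU, fun t ht => hw ⟨_, ht, ?_⟩⟩
  rw [map_add, map_smul, hLv, smul_zero, add_zero]

/-- Two points of a convex open set `B` outside a `μH[d-1]`-null set `S`, closed relative to `B`,
can be joined by a path in `B \ S`. -/
theorem Convex.joinedIn_diff_of_hausdorffMeasure_eq_zero {E : Type*} [NormedAddCommGroup E]
    [NormedSpace ℝ E] [FiniteDimensional ℝ E] [MeasurableSpace E] [BorelSpace E]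
    {S B : Set E} (hS : μH[(Module.finrank ℝ E : ℝ) - 1] S = 0)
    (hB : Convex ℝ B) (hBS : IsOpen (B \ S)) {x y : E} (hx : x ∈ B \ S) (hy : y ∈ B \ S) :
    JoinedIn (B \ S) x y := by
  rcases eq_or_ne x y with rfl | hxy
  · exact JoinedIn.refl hx
  obtain ⟨r, hr, hrx⟩ := Metric.isOpen_iff.1 hBS x hx
  obtain ⟨s, hs, hsy⟩ := Metric.isOpen_iff.1 hBS y hy
  obtain ⟨w, hw, hwS⟩ := exists_mem_line_avoiding_of_hausdorffMeasure_eq_zero hS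
    (sub_ne_zero.2 hxy.symm) (Metric.isOpen_ball (x := x) (ε := min r s))
    ⟨x, Metric.mem_ball_self (lt_min hr hs)⟩
  have hwx : w ∈ Metric.ball x r := Metric.ball_subset_ball (min_le_left _ _) hw
  have hwy : w + (y - x) ∈ Metric.ball y s := by
    have := Metric.ball_subset_ball (min_le_right r s) hw
    rw [mem_ball_iff_norm] at this ⊢
    convert this using 2
    abel
  have h₁ : JoinedIn (B \ S) x w := JoinedIn.of_segment_subset <|
    ((convex_ball x r).segment_subset (Metric.mem_ball_self hr) hwx).trans hrx
  have h₂ : JoinedIn (B \ S) w (w + (y - x)) := by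
    refine JoinedIn.of_segment_subset fun z hz =>
      ⟨hB.segment_subset (hrx hwx).1 (hsy hwy).1 hz, ?_⟩
    rw [segment_eq_image'] at hz
    obtain ⟨t, -, rfl⟩ := hz
    simpa using hwS t
  have h₃ : JoinedIn (B \ S) (w + (y - x)) y := JoinedIn.of_segment_subset <|
    ((convex_ball y s).segment_subset hwy (Metric.mem_ball_self hs)).trans hsy
  exact (h₁.trans h₂).trans h₃

/-- A relatively closed subset `S` of an open connected set `Ω ⊆ ℝ^d` with vanishing
`(d-1)`-dimensional Hausdorff measure does not disconnect `Ω`: the complement `Ω \ S`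
is connected. -/
theorem stmt_7 (d : ℕ) (hd : 1 ≤ d)
    (Ω : Set (EuclideanSpace ℝ (Fin d))) (hΩo : IsOpen Ω) (hΩc : IsConnected Ω)
    (S : Set (EuclideanSpace ℝ (Fin d))) (hSΩ : S ⊆ Ω)
    (hScl : closure S ∩ Ω ⊆ S)
    (hS : μH[(d : ℝ) - 1] S = 0) :
    IsConnected (Ω \ S) := by
  have hS' : μH[(Module.finrank ℝ (EuclideanSpace ℝ (Fin d)) : ℝ) - 1] S = 0 := by
    rwa [finrank_euclideanSpace_fin]
  have : Nontrivial (EuclideanSpace ℝ (Fin d)) :=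
    Module.nontrivial_of_finrank_pos (R := ℝ) (by rw [finrank_euclideanSpace_fin]; omega)
  obtain ⟨v, hv⟩ := exists_ne (0 : EuclideanSpace ℝ (Fin d))
  have hdense : ∀ U : Set (EuclideanSpace ℝ (Fin d)), IsOpen U → U.Nonempty → (U \ S).Nonempty := by
    intro U hU hne
    obtain ⟨w, hw, hwS⟩ := exists_mem_line_avoiding_of_hausdorffMeasure_eq_zero hS' hv hU hne
    exact ⟨w, hw, by simpa using hwS 0⟩
  have hopen : ∀ U ⊆ Ω, IsOpen U → IsOpen (U \ S) := by
    intro U hUΩ hU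
    have : U \ S = U \ closure S := by
      ext z
      exact ⟨fun h => ⟨h.1, fun hz => h.2 (hScl ⟨hz, hUΩ h.1⟩)⟩,
        fun h => ⟨h.1, fun hz => h.2 (subset_closure hz)⟩⟩
    rw [this]
    exact hU.sdiff isClosed_closure
  let P : EuclideanSpace ℝ (Fin d) → EuclideanSpace ℝ (Fin d) → Prop := fun x y =>
    ∃ U V, IsOpen U ∧ IsOpen V ∧ x ∈ U ∧ y ∈ V ∧
      ∀ a ∈ U \ S, ∀ b ∈ V \ S, JoinedIn (Ω \ S) a b
  have hP : ∀ x ∈ Ω, ∀ y ∈ Ω, P x y := by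
    intro x hx y hy
    refine hΩc.isPreconnected.induction₂ P ?_ ?_ ?_ hx hy
    · intro z hz
      obtain ⟨r, hr, hrΩ⟩ := Metric.isOpen_iff.1 hΩo z hz
      filter_upwards [mem_nhdsWithin_of_mem_nhds (Metric.ball_mem_nhds z hr)] with u hu
      exact ⟨_, _, Metric.isOpen_ball, Metric.isOpen_ball, Metric.mem_ball_self hr, hu,
        fun a ha b hb => ((convex_ball z r).joinedIn_diff_of_hausdorffMeasure_eq_zero hS'
          (hopen _ hrΩ Metric.isOpen_ball) ha hb).mono (Set.sdiff_subset_sdiff_left hrΩ)⟩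
    · rintro a b c - - - ⟨U, V, hU, hV, haU, hbV, h⟩ ⟨V', W, hV', hW, hbV', hcW, h'⟩
      obtain ⟨p, ⟨hpV, hpV'⟩, hpS⟩ := hdense _ (hV.inter hV') ⟨b, hbV, hbV'⟩
      exact ⟨U, W, hU, hW, haU, hcW, fun s hs t ht =>
        (h s hs p ⟨hpV, hpS⟩).trans (h' p ⟨hpV', hpS⟩ t ht)⟩
    · rintro a b - - ⟨U, V, hU, hV, haU, hbV, h⟩
      exact ⟨V, U, hV, hU, hbV, haU, fun s hs t ht => (h t ht s hs).symm⟩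
  refine (isPathConnected_iff.2 ⟨hdense Ω hΩo hΩc.nonempty, fun x hx y hy => ?_⟩).isConnected
  obtain ⟨U, V, -, -, hxU, hyV, h⟩ := hP x hx.1 y hy.1
  exact h x ⟨hxU, hx.2⟩ y ⟨hyV, hy.2⟩
end
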